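/- arXiv:2008.08380 — 4 statements merged into one kernel-verified Lean document; each statement's English description precedes it below -/
import Mathlib

section
/- There exist absolute constants c₁, c₂, c₃, c₄ > 0 such that the following holds. Let p ≥ 1, let f be a nonnegative measurable function of a random variable X such that E f(X)^p < ∞ and the distribution of f(X) is atomless. Let N ∈ ℕ, let c₁/N < Δ ≤ 1/2, and let x_1,…,x_N be points such that the sample satisfies Properties (1)–(3) for f with constants λ = 1/2, C = 2 and Δ. Set θ = c₂Δ and Λ = Q_{1−c₃Δ}(f). Then (1/N)·Σ_{j ≥ θN} (f(x_i)^p)_j^* ≤ E f(X)^p + c₄·E_{Λ,p}(f), where the left-hand side is the sum of the values f(x_i)^p after discarding the ⌈θN⌉ largest ones, divided by N. -/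
open MeasureTheory Real

/-- The trimmed mean: discard the `⌈θN⌉` largest values of `z` and average the rest. -/
noncomputable def trimmedMean {N : ℕ} (z : Fin N → ℝ) (θ : ℝ) : ℝ :=
  (N : ℝ)⁻¹ * ∑ j ∈ Finset.univ.filter
      (fun j : Fin N => (j : ℕ) < N - Nat.ceil (θ * N)), z (Tuple.sort z j)

/-- Empirical measure of a set along the sample `x`. -/
noncomputable def empP {Ω : Type*} {N : ℕ} (x : Fin N → Ω) (s : Set Ω) : ℝ :=
  (N : ℝ)⁻¹ * ∑ i : Fin N, s.indicator (fun _ => (1 : ℝ)) (x i)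

/-- Properties (1)-(3) of the sample `x` for the function `f`, with constants `lam`, `C`, `Δ`. -/
def SatisfiesProps {Ω : Type*} [MeasurableSpace Ω] (μ : Measure Ω) (f : Ω → ℝ)
    {N : ℕ} (x : Fin N → Ω) (lam C Δ : ℝ) : Prop :=
  (∀ t : ℝ, 0 < t → Δ ≤ (μ {ω | t < f ω}).toReal →
    |empP x {ω | t < f ω} / (μ {ω | t < f ω}).toReal - 1| ≤ lam) ∧
  (∀ (j : ℕ) (t : ℝ), 0 < t → Δ ≤ 2 ^ (-(j : ℝ)) * (μ {ω | t < f ω}).toReal →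
    |empP x {ω | t < f ω} / (μ {ω | t < f ω}).toReal - 1| ≤ 2 ^ (-(j : ℝ) / 2)) ∧
  (∀ I : Set ℝ, I.OrdConnected →
    empP x {ω | f ω ∈ I} ≤ 3 / 2 * (μ {ω | f ω ∈ I}).toReal + C * Δ)

/-- `Q_{1-η}(f) = inf {t : P(f > t) < η}`. -/
noncomputable def quant {Ω : Type*} [MeasurableSpace Ω] (μ : Measure Ω) (f : Ω → ℝ)
    (η : ℝ) : ℝ :=
  sInf {t : ℝ | (μ {ω | t < f ω}).toReal < η}

/-- `E_{T,p}(f) = 2√Δ ∫_0^T p t^{p-1} √(P(f>t)) dt`. -/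
noncomputable def errE {Ω : Type*} [MeasurableSpace Ω] (μ : Measure Ω) (f : Ω → ℝ)
    (Δ p T : ℝ) : ℝ :=
  2 * Real.sqrt Δ * ∫ t in (0 : ℝ)..T, p * t ^ (p - 1) * Real.sqrt ((μ {ω | t < f ω}).toReal)

theorem intervalIntegrable_rpow_mul_antitone {p : ℝ} (hp : 1 ≤ p) {G : ℝ → ℝ} (hG : Antitone G)
    (a b : ℝ) : IntervalIntegrable (fun t => p * t ^ (p - 1) * G t) volume a b :=
  hG.intervalIntegrable.continuousOn_mul
    (continuous_const.mul (Real.continuous_rpow_const (by linarith))).continuousOn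

theorem antitone_tail {Ω : Type*} [MeasurableSpace Ω] (μ : Measure Ω) [IsProbabilityMeasure μ]
    (f : Ω → ℝ) : Antitone (fun t => (μ {ω | t < f ω}).toReal) := by
  intro s t hst
  exact ENNReal.toReal_mono (measure_ne_top _ _) (measure_mono fun ω (h : t < f ω) => hst.trans_lt h)

theorem antitone_indicator_Iio (y : ℝ) :
    Antitone (fun t => (Set.Iio y).indicator (fun _ => (1 : ℝ)) t) := by
  intro s t hst
  by_cases h : t < y
  · simp [Set.indicator, h, hst.trans_lt h]
  · simp only [Set.indicator, Set.mem_Iio, h, if_false]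
    split_ifs <;> norm_num

theorem min_rpow_le_integral {p : ℝ} (hp : 1 ≤ p) {y T : ℝ} (hy : 0 ≤ y) (hT : 0 ≤ T) :
    min y T ^ p ≤
      ∫ t in (0 : ℝ)..T, p * t ^ (p - 1) * (Set.Iio y).indicator (fun _ => (1 : ℝ)) t := by
  have hm : 0 ≤ min y T := le_min hy hT
  have hint := intervalIntegrable_rpow_mul_antitone hp (antitone_indicator_Iio y)
  have h1 : ∫ t in (0 : ℝ)..(min y T), p * t ^ (p - 1) = min y T ^ p := by
    rw [intervalIntegral.integral_const_mul, integral_rpow (Or.inl (by linarith))]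
    rw [sub_add_cancel, Real.zero_rpow (by linarith)]
    field_simp
    ring
  rw [← h1, ← intervalIntegral.integral_add_adjacent_intervals (hint 0 (min y T)) (hint _ T)]
  have h2 : ∫ t in (0 : ℝ)..(min y T), p * t ^ (p - 1) =
      ∫ t in (0 : ℝ)..(min y T), p * t ^ (p - 1) *
        (Set.Iio y).indicator (fun _ => (1 : ℝ)) t := by
    rw [intervalIntegral.integral_of_le hm, intervalIntegral.integral_of_le hm,
      integral_Ioc_eq_integral_Ioo, integral_Ioc_eq_integral_Ioo]
    refine setIntegral_congr_fun measurableSet_Ioo fun t ht => ?_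
    have : t < y := ht.2.trans_le (min_le_left _ _)
    simp [this]
  have h3 : 0 ≤ ∫ t in (min y T)..T, p * t ^ (p - 1) *
        (Set.Iio y).indicator (fun _ => (1 : ℝ)) t := by
    refine intervalIntegral.integral_nonneg (min_le_right _ _) fun t ht => ?_
    have : 0 ≤ t := hm.trans ht.1
    exact mul_nonneg (by positivity) (Set.indicator_nonneg (by simp) _)
  linarith

theorem integral_rpow_mul_tail_le {Ω : Type*} [MeasurableSpace Ω] {μ : Measure Ω}
    [IsProbabilityMeasure μ] {p : ℝ} (hp : 1 ≤ p) {f : Ω → ℝ} (hf : Measurable f)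
    (hf0 : ∀ ω, 0 ≤ f ω) (hfi : Integrable (fun ω => f ω ^ p) μ) {T : ℝ} (hT : 0 ≤ T) :
    ∫ t in (0 : ℝ)..T, p * t ^ (p - 1) * (μ {ω | t < f ω}).toReal ≤ ∫ ω, f ω ^ p ∂μ := by
  have hp0 : 0 < p := by linarith
  have hnn : ∀ ω, 0 ≤ f ω ^ p := fun ω => Real.rpow_nonneg (hf0 ω) p
  have hint := intervalIntegrable_rpow_mul_antitone hp (antitone_tail μ f) 0 T
  rw [intervalIntegrable_iff_integrableOn_Ioc_of_le hT] at hint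
  rw [intervalIntegral.integral_of_le hT]
  rw [← ENNReal.ofReal_le_ofReal_iff (integral_nonneg hnn),
    ofReal_integral_eq_lintegral_ofReal hfi (.of_forall hnn),
    lintegral_rpow_eq_lintegral_meas_lt_mul μ (.of_forall hf0) hf.aemeasurable hp0,
    ofReal_integral_eq_lintegral_ofReal hint, ← lintegral_const_mul' _ _ ENNReal.ofReal_ne_top]
  · refine (lintegral_mono_set Set.Ioc_subset_Ioi_self).trans
      (setLIntegral_mono' measurableSet_Ioi fun t (ht : 0 < t) => ?_)
    rw [ENNReal.ofReal_mul (by positivity), ENNReal.ofReal_mul hp0.le,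
      ENNReal.ofReal_toReal (measure_ne_top _ _), mul_assoc, mul_comm (μ _)]
  · filter_upwards [self_mem_ae_restrict measurableSet_Ioc] with t ht
    have := ht.1
    simp only [Pi.zero_apply]
    positivity

theorem quant_set_nonempty {Ω : Type*} [MeasurableSpace Ω] {μ : Measure Ω}
    [IsProbabilityMeasure μ] {f : Ω → ℝ} (hf : Measurable f) {η : ℝ} (hη : 0 < η) :
    {t : ℝ | (μ {ω | t < f ω}).toReal < η}.Nonempty := by
  have h := tendsto_measure_iInter_atTop (μ := μ) (s := fun n : ℕ => {ω | (n : ℝ) < f ω})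
    (fun n => (measurableSet_lt measurable_const hf).nullMeasurableSet)
    (fun m n hmn ω (h : (n : ℝ) < f ω) => (Nat.cast_le.2 hmn).trans_lt h)
    ⟨0, measure_ne_top _ _⟩
  have he : ⋂ n : ℕ, {ω | (n : ℝ) < f ω} = ∅ := by
    ext ω
    obtain ⟨n, hn⟩ := exists_nat_ge (f ω)
    simpa using ⟨n, hn⟩
  rw [he, measure_empty] at h
  have h' := (ENNReal.tendsto_toReal ENNReal.zero_ne_top).comp h
  obtain ⟨n, hn⟩ := (h'.eventually (gt_mem_nhds (by simpa using hη))).exists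
  exact ⟨n, hn⟩

theorem quant_set_subset_Ici {Ω : Type*} [MeasurableSpace Ω] {μ : Measure Ω}
    [IsProbabilityMeasure μ] {f : Ω → ℝ} (hf0 : ∀ ω, 0 ≤ f ω) {η : ℝ} (hη : η ≤ 1) :
    {t : ℝ | (μ {ω | t < f ω}).toReal < η} ⊆ Set.Ici 0 := by
  intro t (ht : _ < η)
  by_contra! h
  have huniv : {ω | t < f ω} = Set.univ :=
    Set.eq_univ_of_forall fun ω => (not_le.1 h).trans_le (hf0 ω)
  rw [huniv, measure_univ, ENNReal.toReal_one] at ht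
  linarith

theorem tail_quant_le {Ω : Type*} [MeasurableSpace Ω] {μ : Measure Ω}
    [IsProbabilityMeasure μ] {f : Ω → ℝ} (hf : Measurable f) {η : ℝ} (hη : 0 < η) :
    (μ {ω | quant μ f η < f ω}).toReal ≤ η := by
  set q := quant μ f η with hq
  obtain ⟨u, hu, hgt, hlim⟩ := exists_seq_strictAnti_tendsto q
  have h := tendsto_measure_iUnion_atTop (μ := μ) (s := fun n : ℕ => {ω | u n < f ω})
    (fun m n hmn ω (h : u m < f ω) => (hu.antitone hmn).trans_lt h)
  have he : ⋃ n : ℕ, {ω | u n < f ω} = {ω | q < f ω} := by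
    ext ω
    simp only [Set.mem_iUnion, Set.mem_ofPred_eq]
    constructor
    · rintro ⟨n, hn⟩
      exact (hgt n).trans hn
    · intro h
      exact (hlim.eventually (gt_mem_nhds h)).exists
  rw [he] at h
  refine le_of_tendsto ((ENNReal.tendsto_toReal (measure_ne_top _ _)).comp h)
    (.of_forall fun n => ?_)
  obtain ⟨s, hs, hsn⟩ := exists_lt_of_csInf_lt (quant_set_nonempty hf hη) (hgt n)
  exact (antitone_tail μ f hsn.le).trans (le_of_lt hs)

theorem empP_eq_card {Ω : Type*} {N : ℕ} (x : Fin N → Ω) (f : Ω → ℝ) (t : ℝ) :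
    empP x {ω | t < f ω} = (N : ℝ)⁻¹ * (Finset.univ.filter fun i => t < f (x i)).card := by
  simp [empP, Set.indicator_apply]

/-- If at most `θN` of the entries exceed `b`, the trimmed mean is at most the mean of the
entries truncated at `b`. -/
theorem trimmedMean_le_mean_min {N : ℕ} {z : Fin N → ℝ} {θ b : ℝ}
    (hz : ∀ i, 0 ≤ z i) (hb : 0 ≤ b)
    (hcard : ((Finset.univ.filter fun i => b < z i).card : ℝ) ≤ θ * N) :
    trimmedMean z θ ≤ (N : ℝ)⁻¹ * ∑ i, min (z i) b := by
  unfold trimmedMean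
  refine mul_le_mul_of_nonneg_left ?_ (by positivity)
  rw [← Equiv.sum_comp (Tuple.sort z)]
  calc _ ≤ ∑ j ∈ Finset.univ.filter (fun j : Fin N => (j : ℕ) < N - Nat.ceil (θ * N)),
        min (z (Tuple.sort z j)) b := by
        refine Finset.sum_le_sum fun j hj => le_min le_rfl ?_
        by_contra! hlt
        have hj' : (j : ℕ) < N - Nat.ceil (θ * N) := by simpa using hj
        have hsub : (Finset.Ici j).map (Tuple.sort z).toEmbedding ⊆
            Finset.univ.filter fun i => b < z i := by
          intro i hi
          simp only [Finset.mem_map, Finset.mem_Ici] at hi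
          obtain ⟨k, hk, rfl⟩ := hi
          simpa using hlt.trans_le (Tuple.monotone_sort z hk)
        have h1 := Finset.card_le_card hsub
        rw [Finset.card_map, Fin.card_Ici] at h1
        have h2 : (Finset.univ.filter fun i => b < z i).card ≤ Nat.ceil (θ * N) := by
          exact_mod_cast hcard.trans (Nat.le_ceil _)
        omega
    _ ≤ _ := Finset.sum_le_sum_of_subset_of_nonneg (Finset.filter_subset _ _)
        fun j _ _ => le_min (hz _) hb

theorem mean_min_rpow_le_integral {Ω : Type*} {N : ℕ} (x : Fin N → Ω) {f : Ω → ℝ}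
    (hf0 : ∀ ω, 0 ≤ f ω) {p : ℝ} (hp : 1 ≤ p) {T : ℝ} (hT : 0 ≤ T) :
    (N : ℝ)⁻¹ * ∑ i, min (f (x i)) T ^ p ≤
      ∫ t in (0 : ℝ)..T, p * t ^ (p - 1) * empP x {ω | t < f ω} := by
  have h : ∀ t, p * t ^ (p - 1) * empP x {ω | t < f ω} =
      (N : ℝ)⁻¹ * ∑ i, p * t ^ (p - 1) *
        (Set.Iio (f (x i))).indicator (fun _ => (1 : ℝ)) t := by
    intro t
    rw [empP, ← Finset.mul_sum, mul_left_comm]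
    rfl
  simp_rw [h]
  rw [intervalIntegral.integral_const_mul, intervalIntegral.integral_finsetSum
    fun i _ => intervalIntegrable_rpow_mul_antitone hp (antitone_indicator_Iio _) 0 T]
  gcongr with i
  exact min_rpow_le_integral hp (hf0 _) hT

theorem exists_dyadic_scale {Δ a : ℝ} (hΔ : 0 < Δ) (ha : Δ ≤ a) :
    ∃ j : ℕ, Δ ≤ 2 ^ (-(j : ℝ)) * a ∧ a * 2 ^ (-(j : ℝ) / 2) ≤ 2 * (√Δ * √a) := by
  obtain ⟨j, hj1, hj2⟩ := exists_nat_pow_near ((one_le_div hΔ).2 ha) (one_lt_two (α := ℝ))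
  have ha0 : 0 < a := hΔ.trans_le ha
  refine ⟨j, ?_, ?_⟩
  · rw [Real.rpow_neg two_pos.le, Real.rpow_natCast, inv_mul_eq_div, le_div_iff₀ (by positivity)]
    rw [le_div_iff₀ hΔ] at hj1
    linarith
  · have hs : (2 : ℝ) ^ (-(j : ℝ) / 2) = √((2 ^ j)⁻¹) := by
      rw [Real.sqrt_eq_rpow, ← Real.rpow_natCast, ← Real.rpow_neg two_pos.le,
        ← Real.rpow_mul two_pos.le]
      ring_nf
    rw [hs, ← Real.sqrt_mul hΔ.le]
    refine abs_le_of_sq_le_sq' ?_ (by positivity) |>.2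
    rw [mul_pow, mul_pow, Real.sq_sqrt (by positivity), Real.sq_sqrt (by positivity),
      ← div_eq_mul_inv, div_le_iff₀ (by positivity)]
    rw [div_lt_iff₀ hΔ, pow_succ] at hj2
    nlinarith

theorem SatisfiesProps.empP_le {Ω : Type*} [MeasurableSpace Ω] {μ : Measure Ω} {f : Ω → ℝ}
    {N : ℕ} {x : Fin N → Ω} {lam C Δ : ℝ} (h : SatisfiesProps μ f x lam C Δ) (hΔ : 0 < Δ)
    {t : ℝ} (ht : 0 < t) (hP : Δ ≤ (μ {ω | t < f ω}).toReal) :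
    empP x {ω | t < f ω} ≤
      (μ {ω | t < f ω}).toReal + 2 * √Δ * √((μ {ω | t < f ω}).toReal) := by
  obtain ⟨j, hj, hb⟩ := exists_dyadic_scale hΔ hP
  have h2 := (abs_le.1 (h.2.1 j t ht hj)).2
  have hP0 := hΔ.trans_le hP
  rw [sub_le_iff_le_add, div_le_iff₀ hP0] at h2
  linarith

theorem trimmed_mean_upper_bound :
    ∃ c₁ c₂ c₃ c₄ : ℝ, 0 < c₁ ∧ 0 < c₂ ∧ 0 < c₃ ∧ 0 < c₄ ∧
    ∀ (Ω : Type) (_ : MeasurableSpace Ω) (μ : Measure Ω), IsProbabilityMeasure μ →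
    ∀ (p : ℝ), 1 ≤ p →
    ∀ (f : Ω → ℝ), Measurable f → (∀ ω, 0 ≤ f ω) →
    Integrable (fun ω => f ω ^ p) μ →
    (∀ t : ℝ, μ {ω | f ω = t} = 0) →
    ∀ (N : ℕ) (Δ : ℝ), c₁ / N < Δ → Δ ≤ 1 / 2 →
    ∀ (x : Fin N → Ω), SatisfiesProps μ f x (1 / 2) 2 Δ →
    trimmedMean (fun i => f (x i) ^ p) (c₂ * Δ) ≤
      (∫ ω, f ω ^ p ∂μ) + c₄ * errE μ f Δ p (quant μ f (c₃ * Δ)) := by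
  refine ⟨1, 4, 1, 1, by norm_num, by norm_num, by norm_num, by norm_num, ?_⟩
  intro Ω _ μ _ p hp f hf hf0 hfi _ N Δ hN hΔ x hx
  have hΔ0 : 0 < Δ := lt_of_le_of_lt (by positivity) hN
  have hp0 : 0 < p := by linarith
  rw [one_mul, one_mul, errE]
  set T := quant μ f Δ with hTdef
  have hT : 0 ≤ T := Real.sInf_nonneg (quant_set_subset_Ici hf0 (by linarith))
  have hsets : (Finset.univ.filter fun i => T ^ p < f (x i) ^ p) =
      Finset.univ.filter fun i => T < f (x i) := by
    ext i
    simp [Real.rpow_lt_rpow_iff hT (hf0 _) hp0]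
  have hcard : ((Finset.univ.filter fun i => T ^ p < f (x i) ^ p).card : ℝ) ≤ 4 * Δ * N := by
    rcases Nat.eq_zero_or_pos N with rfl | hNpos
    · simp
    have h3 : empP x {ω | T < f ω} ≤ 3 / 2 * (μ {ω | T < f ω}).toReal + 2 * Δ :=
      hx.2.2 (Set.Ioi T) Set.ordConnected_Ioi
    have htail := tail_quant_le (μ := μ) hf hΔ0
    rw [empP_eq_card, inv_mul_eq_div, div_le_iff₀ (by positivity)] at h3
    rw [hsets]
    refine h3.trans (mul_le_mul_of_nonneg_right ?_ (by positivity))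
    linarith
  have hmin : ∀ i, min (f (x i) ^ p) (T ^ p) = min (f (x i)) T ^ p := fun i =>
    ((Real.monotoneOn_rpow_Ici_of_exponent_nonneg hp0.le).map_min (hf0 _) hT).symm
  have htrim := trimmedMean_le_mean_min (fun i => Real.rpow_nonneg (hf0 (x i)) p)
    (Real.rpow_nonneg hT p) hcard
  simp_rw [hmin] at htrim
  have hemp : Antitone fun t => empP x {ω | t < f ω} := by
    intro s t hst
    exact mul_le_mul_of_nonneg_left
      (Finset.sum_le_sum fun i _ => antitone_indicator_Iio (f (x i)) hst) (by positivity)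
  have hsqrt : Antitone fun t => √((μ {ω | t < f ω}).toReal) :=
    fun s t hst => Real.sqrt_le_sqrt (antitone_tail μ f hst)
  have hi1 := intervalIntegrable_rpow_mul_antitone hp (antitone_tail μ f) 0 T
  have hi2 := (intervalIntegrable_rpow_mul_antitone hp hsqrt 0 T).const_mul (2 * √Δ)
  calc _ ≤ _ := htrim
    _ ≤ _ := mean_min_rpow_le_integral x hf0 hp hT
    _ ≤ ∫ t in (0 : ℝ)..T, (p * t ^ (p - 1) * (μ {ω | t < f ω}).toReal +
          2 * √Δ * (p * t ^ (p - 1) * √((μ {ω | t < f ω}).toReal))) := by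
        refine intervalIntegral.integral_mono_on_of_le_Ioo hT
          (intervalIntegrable_rpow_mul_antitone hp hemp 0 T) (hi1.add hi2) fun t ht => ?_
        have hP : Δ ≤ (μ {ω | t < f ω}).toReal :=
          not_lt.1 (notMem_of_lt_csInf (s := {t : ℝ | (μ {ω | t < f ω}).toReal < Δ}) ht.2
            (bddBelow_Ici.mono (quant_set_subset_Ici hf0 (by linarith))))
        have h0 : 0 ≤ p * t ^ (p - 1) := mul_nonneg hp0.le (Real.rpow_nonneg ht.1.le _)
        have := mul_le_mul_of_nonneg_left (hx.empP_le hΔ0 ht.1 hP) h0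
        linarith
    _ = (∫ t in (0 : ℝ)..T, p * t ^ (p - 1) * (μ {ω | t < f ω}).toReal) +
          2 * √Δ * ∫ t in (0 : ℝ)..T, p * t ^ (p - 1) * √((μ {ω | t < f ω}).toReal) := by
        rw [intervalIntegral.integral_add hi1 hi2, intervalIntegral.integral_const_mul]
    _ ≤ _ := by
        gcongr
        exact integral_rpow_mul_tail_le hp hf hf0 hfi hT
end

section
/- There exist absolute constants c₁, c₂, c₄ > 0 such that the following holds. Let p ≥ 1 and let f be a nonnegative measurable function of a random variable X such that E f(X)^{2p} < ∞ and the distribution of f(X) is atomless. Let N ∈ ℕ, let c₁/N ≤ Δ ≤ 1/2, set θ = c₂Δ, and let x_1,…,x_N be points such that the sample satisfies Properties (1)–(3) for f with constants λ = 1/2, C = 2 and Δ. Then | (1/N)·Σ_{j ≥ θN} (f(x_i)^p)_j^* − E f(X)^p | ≤ c₄·√(Δ·log(1/Δ))·‖f(X)‖_{L_{2p}}^p, where the trimmed mean on the left is the sum of the values f(x_i)^p after discarding the ⌈θN⌉ largest ones, divided by N. -/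
open MeasureTheory Real

/-- The weighted tail integral of a square-integrable function is half its second moment. -/
theorem integrableOn_mul_tail {Ω : Type*} [MeasurableSpace Ω] (μ : Measure Ω)
    [IsProbabilityMeasure μ] {g : Ω → ℝ} (hg : Measurable g) (hg0 : ∀ ω, 0 ≤ g ω)
    (hi : Integrable (fun ω => g ω ^ 2) μ) :
    IntegrableOn (fun s => s * μ.real {ω | s < g ω}) (Set.Ioi 0) ∧
      ∫ s in Set.Ioi (0 : ℝ), s * μ.real {ω | s < g ω} = (∫ ω, g ω ^ 2 ∂μ) / 2 := by
  have key := lintegral_rpow_eq_lintegral_meas_lt_mul μ (f := g)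
    (Filter.Eventually.of_forall hg0) hg.aemeasurable (p := 2) (by norm_num)
  have hH : Measurable fun s : ℝ => μ.real {ω | s < g ω} := by
    refine Antitone.measurable fun s t hst => ?_
    exact measureReal_mono fun ω (h : t < g ω) => lt_of_le_of_lt hst h
  have hnn : 0 ≤ᵐ[volume.restrict (Set.Ioi (0 : ℝ))] fun s => s * μ.real {ω | s < g ω} := by
    filter_upwards [ae_restrict_mem measurableSet_Ioi] with s hs
    exact mul_nonneg (le_of_lt hs) measureReal_nonneg
  have hm : AEStronglyMeasurable (fun s => s * μ.real {ω | s < g ω})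
      (volume.restrict (Set.Ioi (0 : ℝ))) := (measurable_id.mul hH).aestronglyMeasurable
  have hlhs : ∫⁻ ω, ENNReal.ofReal (g ω ^ (2 : ℝ)) ∂μ = ENNReal.ofReal (∫ ω, g ω ^ 2 ∂μ) := by
    rw [ofReal_integral_eq_lintegral_ofReal hi (Filter.Eventually.of_forall fun ω => sq_nonneg _)]
    simp
  have hrhs : ∫⁻ s in Set.Ioi (0 : ℝ), μ {ω | s < g ω} * ENNReal.ofReal (s ^ ((2 : ℝ) - 1)) =
      ∫⁻ s in Set.Ioi (0 : ℝ), ENNReal.ofReal (s * μ.real {ω | s < g ω}) := by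
    refine setLIntegral_congr_fun measurableSet_Ioi fun s hs => ?_
    rw [ENNReal.ofReal_mul (le_of_lt hs), ofReal_measureReal, mul_comm]
    norm_num
  rw [hlhs, hrhs] at key
  have hfin : ∫⁻ s in Set.Ioi (0 : ℝ), ENNReal.ofReal (s * μ.real {ω | s < g ω}) ≠ ⊤ := by
    intro h
    rw [h] at key
    simp at key
  constructor
  · exact (lintegral_ofReal_ne_top_iff_integrable hm hnn).1 hfin
  · rw [integral_eq_lintegral_of_nonneg_ae hnn hm]
    have := congrArg ENNReal.toReal key
    rw [ENNReal.toReal_ofReal (integral_nonneg fun ω => sq_nonneg _), ENNReal.toReal_mul] at this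
    simp only [ENNReal.toReal_ofReal (zero_le_two (α := ℝ))] at this
    linarith

theorem sq_mul_tail_le {Ω : Type*} [MeasurableSpace Ω] (μ : Measure Ω)
    [IsProbabilityMeasure μ] {g : Ω → ℝ} (hi : Integrable (fun ω => g ω ^ 2) μ)
    {s : ℝ} (hs : 0 ≤ s) : s ^ 2 * μ.real {ω | s < g ω} ≤ ∫ ω, g ω ^ 2 ∂μ := by
  refine le_trans ?_ (mul_meas_ge_le_integral_of_nonneg
    (Filter.Eventually.of_forall fun ω => sq_nonneg (g ω)) hi (s ^ 2))
  refine mul_le_mul_of_nonneg_left (measureReal_mono fun ω (h : s < g ω) => ?_) (sq_nonneg s)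
  exact pow_le_pow_left₀ hs h.le 2

theorem sqrt_le_weighted {x b : ℝ} (hx : 0 ≤ x) (hb : 0 < b) :
    √x ≤ (b * x + b⁻¹) / 2 := by
  have h1 : 0 ≤ (b * √x - 1) ^ 2 * b⁻¹ := by positivity
  have h2 : (b * √x - 1) ^ 2 * b⁻¹ = b * √x ^ 2 - 2 * √x + b⁻¹ := by field_simp; ring
  rw [Real.sq_sqrt hx] at h2
  linarith

/-- A function on the half line that is close to the tail of `g`, relatively to the scale `Δ`,
has integral close to the mean of `g`. -/
theorem abs_integral_sub_mean_le {Ω : Type*} [MeasurableSpace Ω] (μ : Measure Ω)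
    [IsProbabilityMeasure μ] {g : Ω → ℝ} (hg : Measurable g) (hg0 : ∀ ω, 0 ≤ g ω)
    (hi : Integrable (fun ω => g ω ^ 2) μ) {σ Δ K : ℝ} (hσ : 0 < σ)
    (hσg : ∫ ω, g ω ^ 2 ∂μ = σ ^ 2) (hΔ : 0 < Δ) (hΔ2 : Δ ≤ 1 / 2) (hK : 0 ≤ K)
    {R : ℝ → ℝ} (hR : IntegrableOn R (Set.Ioi 0))
    (h1 : ∀ s, 0 < s → |R s - μ.real {ω | s < g ω}| ≤ K * √(Δ * μ.real {ω | s < g ω}))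
    (h2 : ∀ s, 0 < s → μ.real {ω | s < g ω} ≤ Δ →
      |R s - μ.real {ω | s < g ω}| ≤ K * μ.real {ω | s < g ω}) :
    |(∫ s in Set.Ioi (0 : ℝ), R s) - ∫ ω, g ω ∂μ| ≤
      K * (5 * √(Δ * log (1 / Δ)) * σ) := by
  set H : ℝ → ℝ := fun s => μ.real {ω | s < g ω} with hHdef
  have hgi : Integrable g μ := by
    have : MemLp g 2 μ := (memLp_two_iff_integrable_sq hg.aestronglyMeasurable).2 hi
    exact this.integrable (by norm_num)
  have hH0 : ∀ s, 0 ≤ H s := fun s => measureReal_nonneg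
  have hH1 : ∀ s, H s ≤ 1 := fun s => measureReal_le_one
  have hHm : Measurable H := by
    refine Antitone.measurable fun s t hst => ?_
    exact measureReal_mono fun ω (h : t < g ω) => lt_of_le_of_lt hst h
  obtain ⟨hsHi, hsH⟩ := integrableOn_mul_tail μ hg hg0 hi
  have hmk : ∀ s, 0 < s → H s ≤ σ ^ 2 * s ^ (-2 : ℝ) := by
    intro s hs
    have := sq_mul_tail_le μ hi hs.le
    rw [hσg] at this
    rw [rpow_neg hs.le, ← div_eq_mul_inv, le_div_iff₀ (by positivity)]
    norm_cast
    linarith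
  set L := log (1 / Δ) with hL
  have hLlog2 : 1 / 4 ≤ L := by
    have h := Real.log_le_log (by norm_num : (0 : ℝ) < 2)
      ((le_div_iff₀ hΔ).2 (by linarith) : (2 : ℝ) ≤ 1 / Δ)
    have := Real.log_two_gt_d9
    linarith
  have hL0 : 0 < L := by linarith
  have hsL : 1 / 2 ≤ √L := Real.le_sqrt_of_sq_le (by linarith)
  have hsL0 : 0 < √L := by linarith
  have hsΔ0 : 0 < √Δ := Real.sqrt_pos.2 hΔ
  have hsΔ1 : √Δ ≤ 1 := Real.sqrt_le_one.2 (by linarith)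
  set S := σ / √Δ with hS
  have hS0 : 0 < S := by positivity
  have hσS : σ ≤ S := by
    rw [hS, le_div_iff₀ hsΔ0]
    nlinarith
  set a := √L / σ with ha
  have ha0 : 0 < a := by positivity
  set D : ℝ → ℝ := fun s => |R s - H s| with hD
  have hHi : IntegrableOn H (Set.Ioi 0) := by
    have hlc : ∫⁻ ω, ENNReal.ofReal (g ω) ∂μ = ∫⁻ t in Set.Ioi (0:ℝ), μ {ω | t < g ω} :=
      lintegral_eq_lintegral_meas_lt μ (Filter.Eventually.of_forall hg0) hg.aemeasurable
    refine (lintegral_ofReal_ne_top_iff_integrable hHm.aestronglyMeasurable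
      (Filter.Eventually.of_forall hH0)).1 ?_
    have hof : (fun s => ENNReal.ofReal (H s)) = fun s => μ {ω | s < g ω} :=
      funext fun s => ofReal_measureReal
    rw [hof, ← hlc]
    exact hgi.lintegral_lt_top.ne
  have hDi : IntegrableOn D (Set.Ioi 0) := (hR.sub hHi).abs
  have hmean : ∫ ω, g ω ∂μ = ∫ s in Set.Ioi (0 : ℝ), H s :=
    hgi.integral_eq_integral_meas_lt (Filter.Eventually.of_forall hg0)
  have hstart : |(∫ s in Set.Ioi (0 : ℝ), R s) - ∫ ω, g ω ∂μ| ≤ ∫ s in Set.Ioi (0 : ℝ), D s := by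
    rw [hmean, ← integral_sub hR hHi]
    exact abs_integral_le_integral_abs
  have hDlow : IntegrableOn D (Set.Ioc 0 σ) := hDi.mono_set Set.Ioc_subset_Ioi_self
  have hDmid : IntegrableOn D (Set.Ioc σ S) :=
    hDi.mono_set (fun s hs => lt_trans hσ hs.1)
  have hDhigh : IntegrableOn D (Set.Ioi S) := hDi.mono_set (Set.Ioi_subset_Ioi hS0.le)
  have hsplit : ∫ s in Set.Ioi (0 : ℝ), D s =
      (∫ s in Set.Ioc 0 σ, D s) + (∫ s in Set.Ioc σ S, D s) + ∫ s in Set.Ioi S, D s := by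
    rw [← setIntegral_union (Set.Ioc_disjoint_Ioc_of_le le_rfl) measurableSet_Ioc hDlow hDmid,
      Set.Ioc_union_Ioc_eq_Ioc hσ.le hσS,
      ← setIntegral_union (Set.Ioc_disjoint_Ioi le_rfl) measurableSet_Ioi
        (hDi.mono_set Set.Ioc_subset_Ioi_self) hDhigh,
      Set.Ioc_union_Ioi_eq_Ioi hS0.le]
  have hlow : ∫ s in Set.Ioc 0 σ, D s ≤ K * (√Δ * σ) := by
    calc ∫ s in Set.Ioc 0 σ, D s ≤ ∫ _ in Set.Ioc 0 σ, K * √Δ := by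
          refine setIntegral_mono_on hDlow (integrableOn_const (by simp)) measurableSet_Ioc fun s hs => ?_
          refine (h1 s hs.1).trans (mul_le_mul_of_nonneg_left (Real.sqrt_le_sqrt ?_) hK)
          nlinarith [hH1 s]
      _ = K * (√Δ * σ) := by simp [hσ.le]; ring
  have hmid : ∫ s in Set.Ioc σ S, D s ≤ K * (√Δ * (√L * σ / 2)) := by
    have hi1 : IntegrableOn (fun s => s * H s) (Set.Ioc σ S) :=
      hsHi.mono_set fun s hs => lt_trans hσ hs.1
    have hi2 : IntegrableOn (fun s : ℝ => s⁻¹) (Set.Ioc σ S) := by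
      rw [← intervalIntegrable_iff_integrableOn_Ioc_of_le hσS]
      refine intervalIntegral.intervalIntegrable_inv (fun s hs => ?_) continuousOn_id
      rw [Set.uIcc_of_le hσS] at hs
      exact (lt_of_lt_of_le hσ hs.1).ne'
    have hv1 : ∫ s in Set.Ioc σ S, s * H s ≤ σ ^ 2 / 2 := by
      rw [← hσg, ← hsH]
      refine setIntegral_mono_set hsHi ?_ (LE.le.eventuallyLE
        fun s hs => lt_trans hσ hs.1)
      filter_upwards [ae_restrict_mem measurableSet_Ioi] with s hs
      exact mul_nonneg (le_of_lt hs) (hH0 s)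
    have hv2 : ∫ s in Set.Ioc σ S, s⁻¹ = L / 2 := by
      rw [← intervalIntegral.integral_of_le hσS, integral_inv_of_pos hσ hS0, hS,
        div_div_cancel_left' hσ.ne', Real.log_inv, Real.log_sqrt hΔ.le, hL, one_div, Real.log_inv]
      ring
    calc ∫ s in Set.Ioc σ S, D s
        ≤ ∫ s in Set.Ioc σ S, (K * √Δ * a / 2 * (s * H s) + K * √Δ / (2 * a) * s⁻¹) := by
          refine setIntegral_mono_on hDmid ((hi1.const_mul _).add (hi2.const_mul _))
            measurableSet_Ioc fun s hs => ?_
          have hs0 : 0 < s := lt_trans hσ hs.1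
          have := h1 s hs0
          rw [Real.sqrt_mul hΔ.le] at this
          refine this.trans ?_
          have h3 := mul_le_mul_of_nonneg_left (sqrt_le_weighted (hH0 s) (mul_pos ha0 hs0))
            (mul_nonneg hK hsΔ0.le)
          calc _ = K * √Δ * √(H s) := by ring
            _ ≤ _ := h3
            _ = _ := by rw [mul_inv]; field_simp
      _ = K * √Δ * a / 2 * (∫ s in Set.Ioc σ S, s * H s) + K * √Δ / (2 * a) * (L / 2) := by
          rw [integral_add (hi1.const_mul _) (hi2.const_mul _), integral_const_mul,
            integral_const_mul, hv2]
      _ ≤ K * √Δ * a / 2 * (σ ^ 2 / 2) + K * √Δ / (2 * a) * (L / 2) := by gcongr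
      _ = K * (√Δ * (√L * σ / 2)) := by
          have : L = √L * √L := (Real.mul_self_sqrt hL0.le).symm
          rw [ha]
          conv_lhs => rw [this]
          rw [Real.sqrt_mul_self hsL0.le]
          field_simp
          ring
  have hhigh : ∫ s in Set.Ioi S, D s ≤ K * (√Δ * σ) := by
    have hi3 : IntegrableOn (fun s : ℝ => s ^ (-2 : ℝ)) (Set.Ioi S) :=
      integrableOn_Ioi_rpow_of_lt (by norm_num) hS0
    calc ∫ s in Set.Ioi S, D s ≤ ∫ s in Set.Ioi S, K * σ ^ 2 * s ^ (-2 : ℝ) := by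
          refine setIntegral_mono_on hDhigh (hi3.const_mul _) measurableSet_Ioi fun s hs => ?_
          have hs' : S < s := hs
          have hs0 : 0 < s := lt_trans hS0 hs
          have hb := hmk s hs0
          have hHΔ : H s ≤ Δ := by
            refine hb.trans ?_
            rw [rpow_neg hs0.le, ← div_eq_mul_inv, div_le_iff₀ (by positivity)]
            norm_cast
            have h4 : σ < s * √Δ := (div_lt_iff₀ hsΔ0).1 hs'
            calc σ ^ 2 ≤ (s * √Δ) ^ 2 := pow_le_pow_left₀ hσ.le h4.le 2
              _ = Δ * s ^ 2 := by rw [mul_pow, Real.sq_sqrt hΔ.le]; ring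
          refine (h2 s hs0 hHΔ).trans ?_
          rw [mul_assoc]
          exact mul_le_mul_of_nonneg_left hb hK
      _ = K * (√Δ * σ) := by
          rw [integral_const_mul, integral_Ioi_rpow_of_lt (by norm_num) hS0]
          norm_num
          rw [rpow_neg_one, hS]
          field_simp
  rw [Real.sqrt_mul hΔ.le]
  have hfin : √Δ * σ ≤ √Δ * σ * (2 * √L) := by
    have : 0 < √Δ * σ := by positivity
    nlinarith
  calc _ ≤ _ := hstart
    _ ≤ K * (√Δ * σ) + K * (√Δ * (√L * σ / 2)) + K * (√Δ * σ) := by rw [hsplit]; gcongr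
    _ = K * (√Δ * σ + √Δ * σ + √Δ * (√L * σ / 2)) := by ring
    _ ≤ K * (5 * (√Δ * √L) * σ) := by
      refine mul_le_mul_of_nonneg_left ?_ hK
      have : 0 < √Δ * √L * σ := by positivity
      nlinarith

/-- The proportion, along the sorted sample, of the untrimmed values exceeding `s`. -/
noncomputable def trimmedTail {N : ℕ} (z : Fin N → ℝ) (k : ℕ) (s : ℝ) : ℝ :=
  (N : ℝ)⁻¹ * ∑ j ∈ Finset.univ.filter (fun j : Fin N => (j : ℕ) < N - k),
    (Set.Iio (z (Tuple.sort z j))).indicator (fun _ => (1 : ℝ)) s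

theorem integral_Ioi_indicator_Iio {a : ℝ} (ha : 0 ≤ a) :
    IntegrableOn ((Set.Iio a).indicator fun _ => (1 : ℝ)) (Set.Ioi 0) ∧
      ∫ s in Set.Ioi (0 : ℝ), (Set.Iio a).indicator (fun _ => (1 : ℝ)) s = a := by
  constructor
  · rw [IntegrableOn, integrable_indicator_iff measurableSet_Iio, IntegrableOn,
      Measure.restrict_restrict measurableSet_Iio, Set.Iio_inter_Ioi]
    exact integrableOn_const (by simp)
  · rw [setIntegral_indicator measurableSet_Iio, Set.Ioi_inter_Iio]
    simp [ha]

theorem integrableOn_trimmedTail {N : ℕ} {z : Fin N → ℝ} (hz : ∀ i, 0 ≤ z i) (k : ℕ) :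
    IntegrableOn (trimmedTail z k) (Set.Ioi 0) := by
  refine Integrable.const_mul (integrable_finsetSum _ fun j _ => ?_) _
  exact (integral_Ioi_indicator_Iio (hz _)).1

/-- Layer-cake formula for the trimmed mean. -/
theorem trimmedMean_eq_integral {N : ℕ} {z : Fin N → ℝ} (hz : ∀ i, 0 ≤ z i) (θ : ℝ) :
    trimmedMean z θ = ∫ s in Set.Ioi (0 : ℝ), trimmedTail z (Nat.ceil (θ * N)) s := by
  simp only [trimmedMean, trimmedTail]
  rw [integral_const_mul, integral_finsetSum _ fun j _ => (integral_Ioi_indicator_Iio (hz _)).1]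
  simp_rw [(integral_Ioi_indicator_Iio (hz _)).2]

/-- The empirical tail of the sample `z`, summed in sorted order. -/
theorem sum_indicator_sort {N : ℕ} (z : Fin N → ℝ) (s : ℝ) :
    ∑ j, (Set.Iio (z (Tuple.sort z j))).indicator (fun _ => (1 : ℝ)) s =
      ∑ i, (Set.Iio (z i)).indicator (fun _ => (1 : ℝ)) s :=
  Equiv.sum_comp (Tuple.sort z) fun i => (Set.Iio (z i)).indicator (fun _ => (1 : ℝ)) s

theorem trimmedTail_le {N : ℕ} {z : Fin N → ℝ} {k : ℕ} {s : ℝ} :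
    trimmedTail z k s ≤ (N : ℝ)⁻¹ * ∑ i, (Set.Iio (z i)).indicator (fun _ => (1 : ℝ)) s := by
  rw [← sum_indicator_sort]
  refine mul_le_mul_of_nonneg_left (Finset.sum_le_sum_of_subset_of_nonneg
    (Finset.filter_subset _ _) fun _ _ _ => ?_) (by positivity)
  exact Set.indicator_nonneg (fun _ _ => zero_le_one) _

theorem le_trimmedTail_add {N : ℕ} {z : Fin N → ℝ} {k : ℕ} {s : ℝ} :
    (N : ℝ)⁻¹ * ∑ i, (Set.Iio (z i)).indicator (fun _ => (1 : ℝ)) s ≤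
      trimmedTail z k s + k / N := by
  rw [← sum_indicator_sort, trimmedTail, div_eq_inv_mul, ← mul_add]
  refine mul_le_mul_of_nonneg_left ?_ (by positivity)
  rw [← Finset.sum_filter_add_sum_filter_not Finset.univ (fun j : Fin N => (j : ℕ) < N - k)]
  gcongr
  calc _ ≤ ∑ j ∈ Finset.univ.filter (fun j : Fin N => ¬ (j : ℕ) < N - k), (1 : ℝ) :=
        Finset.sum_le_sum fun j _ => Set.indicator_le_self' (fun _ _ => zero_le_one) _
    _ = ((Finset.univ.filter (fun j : Fin N => ¬ (j : ℕ) < N - k)).card : ℝ) := by simp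
    _ ≤ k := by
      norm_cast
      have h : (Finset.univ.filter (fun j : Fin N => ¬ (j : ℕ) < N - k)).card ≤
          (Finset.Ico (N - k) N).card := by
        refine Finset.card_le_card_of_injOn (fun j : Fin N => (j : ℕ)) (fun j hj => ?_)
          Fin.val_injective.injOn
        have : ¬ (j : ℕ) < N - k := by simpa using hj
        simp only [Finset.coe_Ico, Set.mem_Ico]
        omega
      rw [Nat.card_Ico] at h
      omega

theorem trimmedTail_eq_zero {N : ℕ} {z : Fin N → ℝ} {k : ℕ} {s : ℝ}
    (h : ∑ i, (Set.Iio (z i)).indicator (fun _ => (1 : ℝ)) s ≤ k) : trimmedTail z k s = 0 := by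
  rw [trimmedTail, Finset.sum_eq_zero, mul_zero]
  intro j hj
  have hjk : (j : ℕ) < N - k := by simpa using hj
  refine Set.indicator_of_notMem (fun hs => ?_) _
  rw [← sum_indicator_sort] at h
  have hlow : ((N - j : ℕ) : ℝ) ≤
      ∑ i, (Set.Iio (z (Tuple.sort z i))).indicator (fun _ => (1 : ℝ)) s := by
    calc ((N - j : ℕ) : ℝ) = ∑ i ∈ Finset.Ici j, (1 : ℝ) := by simp
      _ = ∑ i ∈ Finset.Ici j, (Set.Iio (z (Tuple.sort z i))).indicator (fun _ => (1 : ℝ)) s := by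
          refine Finset.sum_congr rfl fun i hi => (Set.indicator_of_mem ?_ fun _ => (1 : ℝ)).symm
          exact lt_of_lt_of_le hs (Tuple.monotone_sort z (Finset.mem_Ici.1 hi))
      _ ≤ _ := Finset.sum_le_sum_of_subset_of_nonneg (Finset.subset_univ _)
          fun _ _ _ => Set.indicator_nonneg (fun _ _ => zero_le_one) _
  have : N - (j : ℕ) ≤ k := by exact_mod_cast hlow.trans h
  omega

/-- Property (2) bounds the deviation of the empirical tail by `√(2ΔP(f > t))`. -/
theorem SatisfiesProps.abs_sub_le {Ω : Type*} [MeasurableSpace Ω] {μ : Measure Ω}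
    {f : Ω → ℝ} {N : ℕ} {x : Fin N → Ω} {lam C Δ : ℝ} (h : SatisfiesProps μ f x lam C Δ)
    (hΔ : 0 < Δ) {t : ℝ} (ht : 0 < t) (hP : Δ ≤ μ.real {ω | t < f ω}) :
    |empP x {ω | t < f ω} - μ.real {ω | t < f ω}| ≤ √(2 * Δ * μ.real {ω | t < f ω}) := by
  set P := μ.real {ω | t < f ω} with hPdef
  have hP0 : 0 < P := hΔ.trans_le hP
  obtain ⟨j, hj1, hj2⟩ := exists_nat_pow_near ((one_le_div hΔ).2 hP) (one_lt_two (α := ℝ))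
  have hpow : (2 : ℝ) ^ (-(j : ℝ)) = (2 ^ j)⁻¹ := by
    rw [rpow_neg zero_le_two, rpow_natCast]
  have hkey := h.2.1 j t ht (by
    rw [hpow, ← measureReal_def, ← hPdef, inv_mul_eq_div, le_div_iff₀ (by positivity)]
    rw [le_div_iff₀ hΔ] at hj1
    linarith)
  rw [← measureReal_def, ← hPdef] at hkey
  have hrw : empP x {ω | t < f ω} - P = (empP x {ω | t < f ω} / P - 1) * P := by
    field_simp
  rw [hrw, abs_mul, abs_of_pos hP0]
  have hsq : ((2 : ℝ) ^ (-(j : ℝ) / 2)) ^ 2 = (2 ^ j)⁻¹ := by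
    rw [← hpow, ← rpow_natCast, ← rpow_mul zero_le_two]
    norm_num
  refine (mul_le_mul_of_nonneg_right hkey hP0.le).trans (Real.le_sqrt_of_sq_le ?_)
  rw [mul_pow, hsq, inv_mul_le_iff₀ (by positivity)]
  rw [div_lt_iff₀ hΔ, pow_succ] at hj2
  nlinarith

/-- Comparison of the trimmed empirical tail with the true tail at one level. -/
theorem abs_sub_tail_bounds {A H Δ κ R : ℝ} (hΔ : 0 < Δ) (hκ4 : 4 * Δ ≤ κ)
    (hκ5 : κ ≤ 5 * Δ) (hH : 0 ≤ H) (hRA : R ≤ A) (hAR : A ≤ R + κ)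
    (hRz : A ≤ κ → R = 0) (h2 : Δ ≤ H → |A - H| ≤ √(2 * Δ * H)) (h3 : A ≤ 3 / 2 * H + 2 * Δ) :
    |R - H| ≤ 7 * √(Δ * H) ∧ (H ≤ Δ → |R - H| ≤ 7 * H) := by
  have hlow : H < Δ → |R - H| = H := by
    intro h
    rw [hRz (by linarith), zero_sub, abs_neg, abs_of_nonneg hH]
  have hhigh : Δ ≤ H → |R - H| ≤ 7 * √(Δ * H) := by
    intro h
    have h1 := abs_le.1 (h2 h)
    have hs1 : √(2 * Δ * H) ≤ 2 * √(Δ * H) := by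
      refine Real.sqrt_le_iff.2 ⟨by positivity, ?_⟩
      rw [mul_pow, Real.sq_sqrt (by positivity)]
      nlinarith [mul_nonneg hΔ.le hH]
    have hs2 : Δ ≤ √(Δ * H) := Real.le_sqrt_of_sq_le (by nlinarith)
    rw [abs_le]
    constructor <;> linarith
  constructor
  · rcases lt_or_ge H Δ with h | h
    · rw [hlow h]
      have : H ≤ √(Δ * H) := Real.le_sqrt_of_sq_le (by nlinarith)
      linarith [Real.sqrt_nonneg (Δ * H)]
    · exact hhigh h
  · intro h
    rcases h.lt_or_eq with h' | h'
    · rw [hlow h']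
      linarith
    · have := hhigh h'.ge
      rwa [← h', Real.sqrt_mul_self hH] at this

/-- Without atoms, a nonnegative function exceeds some positive level with probability `1 / 2`. -/
theorem exists_pos_half_le_tail {Ω : Type*} [MeasurableSpace Ω] (μ : Measure Ω)
    [IsProbabilityMeasure μ] {f : Ω → ℝ} (hf0 : ∀ ω, 0 ≤ f ω) (h0 : μ {ω | f ω = 0} = 0) :
    ∃ t : ℝ, 0 < t ∧ 1 / 2 ≤ μ.real {ω | t < f ω} := by
  have hmono : Monotone fun n : ℕ => {ω | 1 / ((n : ℝ) + 1) < f ω} := by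
    intro m n hmn ω (hω : 1 / ((m : ℝ) + 1) < f ω)
    exact lt_of_le_of_lt (Nat.one_div_le_one_div hmn) hω
  have hunion : ⋃ n : ℕ, {ω | 1 / ((n : ℝ) + 1) < f ω} = {ω | f ω = 0}ᶜ := by
    ext ω
    simp only [Set.mem_iUnion, Set.mem_ofPred_eq, Set.mem_compl_iff]
    constructor
    · rintro ⟨n, hn⟩ h
      rw [h] at hn
      exact absurd hn (not_lt.2 Nat.one_div_pos_of_nat.le)
    · exact fun h => exists_nat_one_div_lt ((hf0 ω).lt_of_ne' h)
  have hlim := tendsto_measure_iUnion_atTop (μ := μ) hmono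
  have hone : μ {ω | f ω = 0}ᶜ = 1 := prob_compl_eq_one_iff₀ (NullMeasurableSet.of_null h0) |>.2 h0
  rw [hunion, hone] at hlim
  have hev := hlim.eventually (lt_mem_nhds (show ENNReal.ofReal (1 / 2) < 1 by
    rw [← ENNReal.ofReal_one]
    exact (ENNReal.ofReal_lt_ofReal_iff one_pos).2 (by norm_num)))
  obtain ⟨n, hn⟩ := hev.exists
  refine ⟨1 / ((n : ℝ) + 1), Nat.one_div_pos_of_nat, ?_⟩
  exact (ENNReal.ofReal_le_iff_le_toReal (measure_ne_top _ _)).1 hn.le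

theorem trimmed_mean_two_sided_L2p :
    ∃ c₁ c₂ c₄ : ℝ, 0 < c₁ ∧ 0 < c₂ ∧ 0 < c₄ ∧
    ∀ (Ω : Type) (_ : MeasurableSpace Ω) (μ : Measure Ω), IsProbabilityMeasure μ →
    ∀ (p : ℝ), 1 ≤ p →
    ∀ (f : Ω → ℝ), Measurable f → (∀ ω, 0 ≤ f ω) →
    Integrable (fun ω => f ω ^ (2 * p)) μ →
    (∀ t : ℝ, μ {ω | f ω = t} = 0) →
    ∀ (N : ℕ) (Δ : ℝ), c₁ / N ≤ Δ → Δ ≤ 1 / 2 →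
    ∀ (x : Fin N → Ω), SatisfiesProps μ f x (1 / 2) 2 Δ →
    |trimmedMean (fun i => f (x i) ^ p) (c₂ * Δ) - ∫ ω, f ω ^ p ∂μ| ≤
      c₄ * Real.sqrt (Δ * Real.log (1 / Δ)) * (∫ ω, f ω ^ (2 * p) ∂μ) ^ ((1 : ℝ) / 2) := by
  refine ⟨1, 4, 35, one_pos, by norm_num, by norm_num, ?_⟩
  intro Ω _ μ _ p hp f hf hf0 hi hat N Δ hΔN hΔ2 x hx
  have hp0 : 0 < p := by linarith
  have hN : 0 < N := by
    rcases Nat.eq_zero_or_pos N with rfl | h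
    · obtain ⟨t, ht, hPt⟩ := exists_pos_half_le_tail μ hf0 (hat 0)
      have := hx.1 t ht (hΔ2.trans hPt)
      norm_num [empP] at this
    · exact h
  have hN0 : (0 : ℝ) < N := Nat.cast_pos.2 hN
  have hΔ : 0 < Δ := lt_of_lt_of_le (by positivity) hΔN
  have hsq : ∀ ω, (f ω ^ p) ^ 2 = f ω ^ (2 * p) := fun ω => by
    rw [mul_comm, rpow_mul (hf0 ω), rpow_two]
  have hpos : 0 < ∫ ω, f ω ^ (2 * p) ∂μ := by
    rw [integral_pos_iff_support_of_nonneg (fun ω => rpow_nonneg (hf0 ω) _) hi]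
    have hsupp : Function.support (fun ω => f ω ^ (2 * p)) = {ω | f ω = 0}ᶜ := by
      ext ω
      simp [rpow_eq_zero (hf0 ω) (by linarith : 2 * p ≠ 0)]
    rw [hsupp, (prob_compl_eq_one_iff₀ (NullMeasurableSet.of_null (hat 0))).2 (hat 0)]
    exact one_pos
  set σ : ℝ := (∫ ω, f ω ^ (2 * p) ∂μ) ^ ((1 : ℝ) / 2) with hσ
  have hσ0 : 0 < σ := rpow_pos_of_pos hpos _
  have hσ2 : ∫ ω, (f ω ^ p) ^ 2 ∂μ = σ ^ 2 := by
    simp_rw [hsq]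
    rw [hσ, ← Real.sqrt_eq_rpow, Real.sq_sqrt hpos.le]
  have hz : ∀ i, 0 ≤ f (x i) ^ p := fun i => rpow_nonneg (hf0 _) _
  set k := Nat.ceil (4 * Δ * N) with hk
  have hk4 : 4 * Δ ≤ (k : ℝ) / N := (le_div_iff₀ hN0).2 (Nat.le_ceil _)
  have hk5 : (k : ℝ) / N ≤ 5 * Δ := by
    rw [div_le_iff₀ hN0]
    have h1 := (Nat.ceil_lt_add_one (by positivity : 0 ≤ 4 * Δ * N)).le
    rw [div_le_iff₀ hN0] at hΔN
    linarith
  have hlevel : ∀ s, 0 < s →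
      |trimmedTail (fun i => f (x i) ^ p) k s - μ.real {ω | s < f ω ^ p}| ≤
        7 * √(Δ * μ.real {ω | s < f ω ^ p}) ∧
      (μ.real {ω | s < f ω ^ p} ≤ Δ →
        |trimmedTail (fun i => f (x i) ^ p) k s - μ.real {ω | s < f ω ^ p}| ≤
          7 * μ.real {ω | s < f ω ^ p}) := by
    intro s hs
    have hset : {ω | s < f ω ^ p} = {ω | s ^ p⁻¹ < f ω} := by
      ext ω
      exact (rpow_inv_lt_iff_of_pos hs.le (hf0 ω) hp0).symm
    have ht : 0 < s ^ p⁻¹ := rpow_pos_of_pos hs _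
    have hemp : empP x {ω | s ^ p⁻¹ < f ω} =
        (N : ℝ)⁻¹ * ∑ i, (Set.Iio (f (x i) ^ p)).indicator (fun _ => (1 : ℝ)) s := by
      rw [← hset]
      rfl
    rw [hset]
    refine abs_sub_tail_bounds (A := empP x {ω | s ^ p⁻¹ < f ω}) hΔ hk4 hk5 measureReal_nonneg
      ?_ ?_ ?_ (hx.abs_sub_le hΔ ht) (hx.2.2 (Set.Ioi (s ^ p⁻¹)) Set.ordConnected_Ioi)
    · rw [hemp]
      exact trimmedTail_le
    · rw [hemp]
      exact le_trimmedTail_add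
    · rw [hemp, inv_mul_eq_div, div_le_div_iff_of_pos_right hN0]
      exact trimmedTail_eq_zero
  rw [trimmedMean_eq_integral hz]
  refine (abs_integral_sub_mean_le μ (hf.pow_const p) (fun ω => rpow_nonneg (hf0 ω) p)
    (by simpa only [hsq] using hi) hσ0 hσ2 hΔ hΔ2 (by norm_num : (0 : ℝ) ≤ 7)
    (integrableOn_trimmedTail hz k) (fun s hs => (hlevel s hs).1)
    fun s hs => (hlevel s hs).2).trans (le_of_eq ?_)
  ring
end

section
/- Let f be a nonnegative measurable function of a random variable X whose distribution under X is atomless. Let 0 ≤ λ < 1, C ≥ 1, 0 < Δ < 1, and let x_1,…,x_N satisfy Properties (1)–(3) for f with constants λ, C, Δ. Let θ satisfy 4Δ·max{1+λ, C+3/2} ≤ θ < 1, set θ₁ = (θ + 2CΔ)/(1−λ) and θ₂ = (θ − 2CΔ)/(1+λ), and assume θ₁ < 1. Let Q̂ = (f(x_i))^*_{⌈θN⌉} be the ⌈θN⌉-th largest among the sample values f(x_1),…,f(x_N). Then Q_{1−θ₁}(f) < Q̂ < Q_{1−θ₂}(f). -/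
open MeasureTheory Real

/-- The `k`-th largest value (1-indexed) among `z 0, …, z (N-1)`. -/
noncomputable def kthLargest {N : ℕ} (z : Fin N → ℝ) (k : ℕ) : ℝ :=
  if h : N - k < N then z (Tuple.sort z ⟨N - k, h⟩) else 0

open ProbabilityTheory Set Filter Topology in
lemma continuous_cdf_of_nullSingletonClass (ν : Measure ℝ) [IsProbabilityMeasure ν]
    [NullSingletonClass ν] : Continuous (cdf ν) := by
  refine continuous_iff_continuousAt.2 fun a => ?_
  rw [(monotone_cdf ν).continuousAt_iff_leftLim_eq_rightLim, StieltjesFunction.rightLim_eq]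
  have h := (cdf ν).measure_singleton a
  rw [measure_cdf, measure_singleton, eq_comm, ENNReal.ofReal_eq_zero] at h
  exact le_antisymm ((monotone_cdf ν).leftLim_le le_rfl) (by linarith)

section Quantile

open ProbabilityTheory Set Filter Topology

variable {Ω : Type*} [MeasurableSpace Ω] {μ : Measure Ω} {f : Ω → ℝ}

lemma nullSingletonClass_map (hf : Measurable f) (hatomless : ∀ t : ℝ, μ {ω | f ω = t} = 0) :
    NullSingletonClass (μ.map f) :=
  ⟨fun t => by rw [Measure.map_apply hf (measurableSet_singleton t)]; exact hatomless t⟩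

variable [IsProbabilityMeasure μ]

lemma tail_eq_one_sub_cdf (hf : Measurable f) (t : ℝ) :
    (μ {ω | t < f ω}).toReal = 1 - cdf (μ.map f) t := by
  have := Measure.isProbabilityMeasure_map (μ := μ) hf.aemeasurable
  rw [cdf_eq_real, ← probReal_compl_eq_one_sub measurableSet_Iic, compl_Iic,
    map_measureReal_apply hf measurableSet_Ioi]
  rfl

lemma tail_zero (hf : Measurable f) (hnonneg : ∀ ω, 0 ≤ f ω)
    (hatomless : ∀ t : ℝ, μ {ω | f ω = t} = 0) : (μ {ω | 0 < f ω}).toReal = 1 := by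
  have h : μ {ω | 0 < f ω}ᶜ = 0 := by
    rw [← hatomless 0]
    congr 1
    ext ω
    simpa using (hnonneg ω).ge_iff_eq'
  rw [(prob_compl_eq_zero_iff (measurableSet_lt measurable_const hf)).1 h, ENNReal.toReal_one]

/-- For an atomless nonnegative `f`, the quantile is positive and is attained exactly. -/
lemma quant_pos_and_tail_quant (hf : Measurable f) (hnonneg : ∀ ω, 0 ≤ f ω)
    (hatomless : ∀ t : ℝ, μ {ω | f ω = t} = 0) {η : ℝ} (hη0 : 0 < η) (hη1 : η < 1) :
    0 < quant μ f η ∧ (μ {ω | quant μ f η < f ω}).toReal = η := by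
  have := Measure.isProbabilityMeasure_map (μ := μ) hf.aemeasurable
  have := nullSingletonClass_map hf hatomless
  have hcont : Continuous fun t : ℝ => (μ {ω | t < f ω}).toReal := by
    simp_rw [tail_eq_one_sub_cdf hf]
    exact continuous_const.sub (continuous_cdf_of_nullSingletonClass _)
  have hlim : Tendsto (fun t : ℝ => (μ {ω | t < f ω}).toReal) atTop (𝓝 0) := by
    simp_rw [tail_eq_one_sub_cdf hf]
    simpa using (tendsto_cdf_atTop (μ.map f)).const_sub 1
  have hanti : Antitone fun t : ℝ => (μ {ω | t < f ω}).toReal := by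
    simp_rw [tail_eq_one_sub_cdf hf]
    exact fun s t h => sub_le_sub_left (monotone_cdf _ h) 1
  have hzero := tail_zero hf hnonneg hatomless
  set S : Set ℝ := {t : ℝ | (μ {ω | t < f ω}).toReal < η}
  have hpos : ∀ t ∈ S, 0 < t := by
    intro t ht
    by_contra! h
    have h1 := hanti h
    have h2 : (μ {ω | t < f ω}).toReal < η := ht
    simp only at h1
    linarith
  have hne : S.Nonempty := (hlim.eventually_lt_const hη0).exists
  have hbdd : BddBelow S := ⟨0, fun t ht => (hpos t ht).le⟩
  have hopen : IsOpen S := isOpen_lt hcont continuous_const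
  have hle : (μ {ω | quant μ f η < f ω}).toReal ≤ η :=
    closure_minimal (fun t (ht : _ < η) => ht.le) (isClosed_le hcont continuous_const)
      (csInf_mem_closure hne hbdd)
  have hge : η ≤ (μ {ω | quant μ f η < f ω}).toReal := by
    by_contra! hlt
    obtain ⟨t, ht, htS⟩ :=
      Filter.nonempty_of_mem (inter_mem (mem_nhdsWithin_of_mem_nhds (hopen.mem_nhds hlt))
        (self_mem_nhdsWithin (s := Iio (quant μ f η))))
    exact absurd (csInf_le hbdd ht) (not_le.2 htS)
  have h0 : 0 ≤ quant μ f η := le_csInf hne fun t ht => (hpos t ht).le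
  refine ⟨h0.lt_of_ne fun h => ?_, hle.antisymm hge⟩
  rw [← h] at hle
  linarith

end Quantile

section OrderStatistics

variable {N : ℕ}

lemma kthLargest_eq (z : Fin N → ℝ) {k : ℕ} (h0 : 0 < k) (hk : k ≤ N) :
    kthLargest z k = z (Tuple.sort z ⟨N - k, by omega⟩) :=
  dif_pos (by omega)

lemma lt_kthLargest (z : Fin N → ℝ) {k : ℕ} (h0 : 0 < k) (hk : k ≤ N) {q : ℝ}
    (h : k ≤ (Finset.univ.filter fun i => q < z i).card) : q < kthLargest z k := by
  rw [kthLargest_eq z h0 hk]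
  by_contra! hle
  have hsub : (Finset.univ.filter fun i => q < z i) ⊆
      (Finset.Ioi (⟨N - k, by omega⟩ : Fin N)).map (Tuple.sort z).toEmbedding := by
    intro i hi
    rw [Finset.mem_map_equiv, Finset.mem_Ioi]
    by_contra! hj
    have h1 := Tuple.monotone_sort z hj
    simp only [Function.comp_apply, Equiv.apply_symm_apply] at h1
    have h2 := (Finset.mem_filter.1 hi).2
    linarith
  have hcard := Finset.card_le_card hsub
  rw [Finset.card_map, Fin.card_Ioi] at hcard
  simp only at hcard
  omega

lemma kthLargest_lt (z : Fin N → ℝ) {k : ℕ} (h0 : 0 < k) (hk : k ≤ N) {q : ℝ}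
    (h : (Finset.univ.filter fun i => q ≤ z i).card < k) : kthLargest z k < q := by
  rw [kthLargest_eq z h0 hk]
  by_contra! hle
  have hsub : (Finset.Ici (⟨N - k, by omega⟩ : Fin N)).map (Tuple.sort z).toEmbedding ⊆
      Finset.univ.filter fun i => q ≤ z i := by
    intro i hi
    rw [Finset.mem_map_equiv, Finset.mem_Ici] at hi
    have h1 := Tuple.monotone_sort z hi
    simp only [Function.comp_apply, Equiv.apply_symm_apply] at h1
    exact Finset.mem_filter.2 ⟨Finset.mem_univ _, hle.trans h1⟩
  have hcard := Finset.card_le_card hsub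
  rw [Finset.card_map, Fin.card_Ici] at hcard
  simp only at hcard
  omega

end OrderStatistics

lemma card_filter_eq_empP {Ω : Type*} {N : ℕ} (hN : 0 < N) (x : Fin N → Ω) (p : Ω → Prop)
    [DecidablePred p] :
    ((Finset.univ.filter fun i => p (x i)).card : ℝ) = empP x {ω | p ω} * N := by
  have hN' : (N : ℝ) ≠ 0 := by positivity
  simp only [empP, Set.indicator_apply, Set.mem_ofPred_eq]
  rw [Finset.card_filter]
  push_cast
  field_simp

lemma empP_le_eq {Ω : Type*} {N : ℕ} (x : Fin N → Ω) (f : Ω → ℝ) (q : ℝ) :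
    empP x {ω | q ≤ f ω} = empP x {ω | q < f ω} + empP x {ω | f ω = q} := by
  simp only [empP, ← mul_add, ← Finset.sum_add_distrib, Set.indicator_apply, Set.mem_ofPred_eq]
  congr 1
  refine Finset.sum_congr rfl fun i _ => ?_
  rcases lt_trichotomy q (f (x i)) with h | h | h
  · simp [h, h.le, h.ne']
  · simp [h]
  · simp [h.not_ge, h.not_gt, h.ne]

theorem empirical_quantile_estimate
    (Ω : Type) [MeasurableSpace Ω] (μ : Measure Ω) [IsProbabilityMeasure μ]
    (f : Ω → ℝ) (hmeas : Measurable f) (hnonneg : ∀ ω, 0 ≤ f ω)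
    (hatomless : ∀ t : ℝ, μ {ω | f ω = t} = 0)
    (lam C Δ : ℝ) (hlam0 : 0 ≤ lam) (hlam1 : lam < 1) (hC : 1 ≤ C)
    (hΔ0 : 0 < Δ) (hΔ1 : Δ < 1)
    (N : ℕ) (hN : 0 < N) (x : Fin N → Ω) (hprops : SatisfiesProps μ f x lam C Δ)
    (θ : ℝ) (hθlow : 4 * Δ * max (1 + lam) (C + 3 / 2) ≤ θ) (hθhigh : θ < 1)
    (hθ₁ : (θ + 2 * C * Δ) / (1 - lam) < 1) :
    quant μ f ((θ + 2 * C * Δ) / (1 - lam)) < kthLargest (fun i => f (x i)) (Nat.ceil (θ * N)) ∧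
    kthLargest (fun i => f (x i)) (Nat.ceil (θ * N)) < quant μ f ((θ - 2 * C * Δ) / (1 + lam)) := by
  obtain ⟨hratio, -, hinterval⟩ := hprops
  have hlow₁ : 4 * Δ * (1 + lam) ≤ θ :=
    (mul_le_mul_of_nonneg_left (le_max_left _ _) (by positivity)).trans hθlow
  have hlow₂ : 4 * Δ * (C + 3 / 2) ≤ θ :=
    (mul_le_mul_of_nonneg_left (le_max_right _ _) (by positivity)).trans hθlow
  have hCΔ : 0 < C * Δ := by positivity
  have hΔlam : 0 ≤ Δ * lam := by positivity
  have hθ0 : 0 < θ := by nlinarith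
  have hNpos : (0 : ℝ) < N := by exact_mod_cast hN
  have hk0 : 0 < Nat.ceil (θ * N) := Nat.ceil_pos.2 (by positivity)
  have hkN : Nat.ceil (θ * N) ≤ N := Nat.ceil_le.2 (by nlinarith)
  have hsub : 0 < 1 - lam := by linarith
  have hadd : 0 < 1 + lam := by linarith
  constructor
  · set η := (θ + 2 * C * Δ) / (1 - lam) with hη
    have hmul : η * (1 - lam) = θ + 2 * C * Δ := div_mul_cancel₀ _ hsub.ne'
    have hΔη : Δ ≤ η := by
      rw [hη, le_div_iff₀ hsub]
      nlinarith
    obtain ⟨hq, htail⟩ :=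
      quant_pos_and_tail_quant hmeas hnonneg hatomless (hΔ0.trans_le hΔη) hθ₁
    have hr := hratio _ hq (by rwa [htail])
    rw [htail] at hr
    have hr' := (abs_le.1 hr).1
    have hemp : η * (1 - lam) ≤ empP x {ω | quant μ f η < f ω} := by
      rw [mul_comm, ← le_div_iff₀ (hΔ0.trans_le hΔη)]
      linarith
    refine lt_kthLargest _ hk0 hkN (Nat.ceil_le.2 ?_)
    rw [card_filter_eq_empP hN x fun ω => quant μ f η < f ω]
    exact mul_le_mul_of_nonneg_right (by linarith) hNpos.le
  · set η := (θ - 2 * C * Δ) / (1 + lam) with hη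
    have hmul : η * (1 + lam) = θ - 2 * C * Δ := div_mul_cancel₀ _ hadd.ne'
    have hΔη : Δ ≤ η := by
      rw [hη, le_div_iff₀ hadd]
      nlinarith
    have hη1 : η < 1 := by
      rw [hη, div_lt_one hadd]
      linarith
    obtain ⟨hq, htail⟩ :=
      quant_pos_and_tail_quant hmeas hnonneg hatomless (hΔ0.trans_le hΔη) hη1
    have hr := hratio _ hq (by rwa [htail])
    rw [htail] at hr
    have hr' := (abs_le.1 hr).2
    have hemp : empP x {ω | quant μ f η < f ω} ≤ η * (1 + lam) := by
      rw [mul_comm, ← div_le_iff₀ (hΔ0.trans_le hΔη)]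
      linarith
    have hatom := hinterval {quant μ f η} Set.ordConnected_singleton
    simp only [Set.mem_singleton_iff, hatomless, ENNReal.toReal_zero, mul_zero, zero_add] at hatom
    refine kthLargest_lt _ hk0 hkN (Nat.lt_ceil.2 ?_)
    rw [card_filter_eq_empP hN x fun ω => quant μ f η ≤ f ω, empP_le_eq]
    exact mul_lt_mul_of_pos_right (by linarith) hNpos
end

section
/- Let p ≥ 1, let f be a nonnegative measurable function of a random variable X with E f(X)^p < ∞, let 0 < Δ ≤ 1/2, and let T > 0 satisfy P(f > T) ≥ Δ. Suppose the points x_1,…,x_N satisfy: for every 0 < t < T and every natural number j, if 2^{−j}·P(f > t) ≥ Δ then |P_N(f > t)/P(f > t) − 1| ≤ 2^{−j/2}. Then ∫_0^T p·t^{p−1}·P_N(f > t) dt ≤ E f(X)^p + E_{T,p}(f). -/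
open MeasureTheory Real

/-- The empirical measure is monotone in the set. -/
lemma empP_mono {Ω : Type*} {N : ℕ} (x : Fin N → Ω) {s t : Set Ω} (h : s ⊆ t) :
    empP x s ≤ empP x t := by
  unfold empP
  refine mul_le_mul_of_nonneg_left (Finset.sum_le_sum fun i _ => ?_) (by positivity)
  exact Set.indicator_le_indicator_of_subset h (fun _ => zero_le_one) _

lemma antitone_measure_toReal_lt {Ω : Type*} [MeasurableSpace Ω] (μ : Measure Ω)
    [IsFiniteMeasure μ] (f : Ω → ℝ) : Antitone fun t : ℝ => (μ {ω | t < f ω}).toReal :=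
  fun _ _ h => ENNReal.toReal_mono (measure_ne_top _ _)
    (measure_mono fun _ hω => lt_of_le_of_lt h hω)

/-- A dyadic family of ratio bounds, applied at the largest admissible scale. -/
lemma le_add_two_mul_sqrt_of_dyadic_ratio {a q Δ : ℝ} (hΔ : 0 < Δ) (hq : Δ ≤ q)
    (h : ∀ j : ℕ, Δ ≤ 2 ^ (-(j : ℝ)) * q → |a / q - 1| ≤ 2 ^ (-(j : ℝ) / 2)) :
    a ≤ q + 2 * √Δ * √q := by
  have hq0 : 0 < q := hΔ.trans_le hq
  obtain ⟨j, hj, hj'⟩ := exists_nat_pow_near ((one_le_div hΔ).2 hq) (one_lt_two (α := ℝ))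
  rw [le_div_iff₀ hΔ] at hj
  rw [div_lt_iff₀ hΔ] at hj'
  have hpow : (2 : ℝ) ^ (-(j : ℝ)) = ((2 : ℝ) ^ j)⁻¹ := by
    rw [rpow_neg zero_le_two, rpow_natCast]
  have hj0 : (0 : ℝ) < 2 ^ j := by positivity
  have hb := h j (by rw [hpow, inv_mul_eq_div, le_div_iff₀ hj0]; linarith)
  have hsqrt : (2 : ℝ) ^ (-(j : ℝ) / 2) = √(((2 : ℝ) ^ j)⁻¹) := by
    rw [← hpow, sqrt_eq_rpow, ← rpow_mul zero_le_two]
    ring_nf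
  have hinv : ((2 : ℝ) ^ j)⁻¹ ≤ 4 * Δ / q := by
    rw [inv_le_iff_one_le_mul₀ hj0, div_mul_eq_mul_div, le_div_iff₀ hq0]
    rw [pow_succ] at hj'
    nlinarith [mul_pos hj0 hΔ]
  have h4 : √(4 * Δ / q) * q = 2 * √Δ * √q := by
    rw [sqrt_div (by positivity), sqrt_mul (by norm_num), show (4 : ℝ) = 2 ^ 2 by norm_num,
      sqrt_sq zero_le_two, div_mul_eq_mul_div, mul_div_assoc, div_sqrt]
  have ha : a / q ≤ 1 + √(4 * Δ / q) := by
    have := (le_abs_self _).trans hb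
    rw [hsqrt] at this
    linarith [sqrt_le_sqrt hinv]
  rw [div_le_iff₀ hq0, add_mul, h4] at ha
  linarith

lemma intervalIntegrable_mul_rpow_mul_of_antitone {p T : ℝ} (hp : 1 ≤ p) {g : ℝ → ℝ}
    (hg : Antitone g) :
    IntervalIntegrable (fun t => p * t ^ (p - 1) * g t) volume 0 T :=
  hg.intervalIntegrable.continuousOn_mul
    (continuous_const.mul (continuous_id.rpow_const fun _ => Or.inr (by linarith))).continuousOn

/-- The truncated layer-cake integral is at most the `p`-th moment. -/
lemma integral_mul_rpow_mul_measure_lt_le {Ω : Type*} [MeasurableSpace Ω] {μ : Measure Ω}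
    [IsFiniteMeasure μ] {p T : ℝ} (hp : 1 ≤ p) (hT : 0 ≤ T) {f : Ω → ℝ}
    (hmeas : AEMeasurable f μ) (hnonneg : ∀ ω, 0 ≤ f ω) (hint : Integrable (fun ω => f ω ^ p) μ) :
    (∫ t in (0 : ℝ)..T, p * t ^ (p - 1) * (μ {ω | t < f ω}).toReal) ≤ ∫ ω, f ω ^ p ∂μ := by
  have hp0 : 0 < p := by linarith
  have hpow : ∀ ω, 0 ≤ f ω ^ p := fun ω => rpow_nonneg (hnonneg ω) p
  have hii := intervalIntegrable_mul_rpow_mul_of_antitone (T := T) hp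
    (antitone_measure_toReal_lt μ f)
  rw [← ENNReal.ofReal_le_ofReal_iff (integral_nonneg hpow),
    ofReal_integral_eq_lintegral_ofReal hint (ae_of_all _ hpow),
    lintegral_rpow_eq_lintegral_meas_lt_mul μ (ae_of_all _ hnonneg) hmeas hp0,
    intervalIntegral.integral_of_le hT,
    ofReal_integral_eq_lintegral_ofReal hii.1
      ((ae_restrict_mem measurableSet_Ioc).mono fun t ht => mul_nonneg
        (mul_nonneg hp0.le (rpow_nonneg ht.1.le _)) ENNReal.toReal_nonneg),
    ← lintegral_const_mul' _ _ ENNReal.ofReal_ne_top]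
  refine le_trans (le_of_eq (setLIntegral_congr_fun measurableSet_Ioc fun t ht => ?_))
    (lintegral_mono_set Set.Ioc_subset_Ioi_self)
  have ht0 : 0 ≤ t ^ (p - 1) := rpow_nonneg ht.1.le _
  rw [ENNReal.ofReal_mul (mul_nonneg hp0.le ht0), ENNReal.ofReal_mul hp0.le,
    ENNReal.ofReal_toReal (measure_ne_top _ _), mul_assoc, mul_comm (ENNReal.ofReal (t ^ (p - 1)))]

theorem empirical_tail_integral_upper
    (Ω : Type) [MeasurableSpace Ω] (μ : Measure Ω) [IsProbabilityMeasure μ]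
    (p : ℝ) (hp : 1 ≤ p)
    (f : Ω → ℝ) (hmeas : Measurable f) (hnonneg : ∀ ω, 0 ≤ f ω)
    (hint : Integrable (fun ω => f ω ^ p) μ)
    (Δ : ℝ) (hΔ0 : 0 < Δ) (hΔ1 : Δ ≤ 1 / 2)
    (T : ℝ) (hT : 0 < T) (hTmeas : Δ ≤ (μ {ω | T < f ω}).toReal)
    (N : ℕ) (x : Fin N → Ω)
    (hratio : ∀ t : ℝ, 0 < t → t < T → ∀ j : ℕ,
      Δ ≤ 2 ^ (-(j : ℝ)) * (μ {ω | t < f ω}).toReal →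
      |empP x {ω | t < f ω} / (μ {ω | t < f ω}).toReal - 1| ≤ 2 ^ (-(j : ℝ) / 2)) :
    (∫ t in (0 : ℝ)..T, p * t ^ (p - 1) * empP x {ω | t < f ω}) ≤
      (∫ ω, f ω ^ p ∂μ) + errE μ f Δ p T := by
  have hq := antitone_measure_toReal_lt μ f
  have hemp : Antitone fun t : ℝ => empP x {ω | t < f ω} :=
    fun _ _ h => empP_mono x fun _ hω => lt_of_le_of_lt h hω
  have hsqrt : Antitone fun t : ℝ => √((μ {ω | t < f ω}).toReal) :=
    fun _ _ h => sqrt_le_sqrt (hq h)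
  have hi₁ := intervalIntegrable_mul_rpow_mul_of_antitone (T := T) hp hq
  have hi₂ := (intervalIntegrable_mul_rpow_mul_of_antitone (T := T) hp hsqrt).const_mul (2 * √Δ)
  calc (∫ t in (0 : ℝ)..T, p * t ^ (p - 1) * empP x {ω | t < f ω})
      ≤ ∫ t in (0 : ℝ)..T, (p * t ^ (p - 1) * (μ {ω | t < f ω}).toReal +
          2 * √Δ * (p * t ^ (p - 1) * √((μ {ω | t < f ω}).toReal))) := by
        refine intervalIntegral.integral_mono_on_of_le_Ioo hT.le
          (intervalIntegrable_mul_rpow_mul_of_antitone hp hemp) (hi₁.add hi₂) fun t ht => ?_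
        have hbound := le_add_two_mul_sqrt_of_dyadic_ratio hΔ0 (hTmeas.trans (hq ht.2.le))
          (hratio t ht.1 ht.2)
        have hw : 0 ≤ p * t ^ (p - 1) := mul_nonneg (by linarith) (rpow_nonneg ht.1.le _)
        exact (mul_le_mul_of_nonneg_left hbound hw).trans_eq (by ring)
    _ = (∫ t in (0 : ℝ)..T, p * t ^ (p - 1) * (μ {ω | t < f ω}).toReal) + errE μ f Δ p T := by
        rw [intervalIntegral.integral_add hi₁ hi₂, intervalIntegral.integral_const_mul, errE]
    _ ≤ (∫ ω, f ω ^ p ∂μ) + errE μ f Δ p T :=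
        add_le_add_left
          (integral_mul_rpow_mul_measure_lt_le hp hT.le hmeas.aemeasurable hnonneg hint) _
end
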